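/- arXiv:2108.02946 — 5 statements merged into one kernel-verified Lean document; each statement's English description precedes it below -/
import Mathlib

section
/- Let N := ℤ·1 + ℤ·(H − 5L + (5/3)P) + ℤ·(L + (1/2)P) + ℤ·P ⊆ R (the numerical Grothendieck group of the derived category of a GM threefold X), and let e := 2 + H + L − (1/3)P ∈ R (the Chern character of the bundle 𝓔^∨ on X). Then the subgroup {u ∈ N : χ(1, u) = 0 and χ(e, u) = 0} (the numerical Grothendieck group of the alternative Kuznetsov component 𝒜_X = ⟨𝒪_X, 𝓔^∨⟩^⊥) is free of rank 2 with ℤ-basis x := 1 − 2L and y := H − 4L − (5/6)P; that is, {u ∈ N : χ(1,u) = 0 = χ(e,u)} = ℤ·x ⊕ ℤ·y. -/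
namespace GMpaper

/-- The numerical intersection ring of a GM threefold, with basis `1, H, L, P`:
an element `(r, c, s, t)` stands for `r·1 + c·H + s·L + t·P`. -/
abbrev R4 : Type := ℚ × ℚ × ℚ × ℚ

/-- Multiplication determined by `H·H = 10L`, `H·L = P`, all other products of
basis elements (other than with `1`) being zero. -/
def mul' (u v : R4) : R4 :=
  (u.1 * v.1,
   u.1 * v.2.1 + u.2.1 * v.1,
   u.1 * v.2.2.1 + u.2.2.1 * v.1 + 10 * (u.2.1 * v.2.1),
   u.1 * v.2.2.2 + u.2.2.2 * v.1 + u.2.1 * v.2.2.1 + u.2.2.1 * v.2.1)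

/-- The involution `1 ↦ 1, H ↦ -H, L ↦ L, P ↦ -P`. -/
def star (u : R4) : R4 := (u.1, -u.2.1, u.2.2.1, -u.2.2.2)

/-- Hirzebruch–Riemann–Roch: `χ₀(x + yH + zL + wP) = x + (17/6)y + (1/2)z + w`. -/
def chi0 (u : R4) : ℚ := u.1 + (17/6) * u.2.1 + (1/2) * u.2.2.1 + u.2.2.2

/-- The Euler pairing `χ(u,v) = χ₀(u* · v)`. -/
def chi (u v : R4) : ℚ := chi0 (mul' (star u) v)

/-- `1 ∈ R`. -/
def one' : R4 := (1, 0, 0, 0)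
/-- `H - 5L + (5/3)P`. -/
def n2 : R4 := (0, 1, -5, 5/3)
/-- `L + (1/2)P`. -/
def n3 : R4 := (0, 0, 1, 1/2)
/-- `P`. -/
def n4 : R4 := (0, 0, 0, 1)
/-- `e = 2 + H + L - (1/3)P`, the Chern character of `𝓔^∨`. -/
def e : R4 := (2, 1, 1, -1/3)
/-- `x = 1 - 2L`. -/
def x : R4 := (1, 0, -2, 0)
/-- `y = H - 4L - (5/6)P`. -/
def y : R4 := (0, 1, -4, -5/6)

/-- The subgroup `{u ∈ N : χ(1,u) = 0 = χ(e,u)}` (the numerical Grothendieck group of the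
alternative Kuznetsov component `𝒜_X`) equals `ℤ·x ⊕ ℤ·y`, where `N` is the `ℤ`-span of
`1, H - 5L + (5/3)P, L + (1/2)P, P`, and `x, y` are `ℤ`-linearly independent, so this
subgroup is free of rank `2` with basis `x = 1 - 2L`, `y = H - 4L - (5/6)P`. -/
theorem stmt0 :
    ({u : R4 | (∃ a b c d : ℤ, u = a • one' + b • n2 + c • n3 + d • n4) ∧
        chi one' u = 0 ∧ chi e u = 0} =
      {u : R4 | ∃ a b : ℤ, u = a • x + b • y}) ∧
    (∀ a b : ℤ, (a • x + b • y : R4) = 0 → a = 0 ∧ b = 0) := by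
  constructor
  · ext u
    simp only [Set.mem_setOf_eq]
    constructor
    · rintro ⟨⟨a, b, c, d, rfl⟩, h1, h2⟩
      refine ⟨a, b, ?_⟩
      simp [chi, chi0, mul', star, one', n2, n3, n4, e] at h1 h2
      simp [one', n2, n3, n4, x, y]
      constructor <;> linarith
    · rintro ⟨a, b, rfl⟩
      refine ⟨⟨a, b, b - 2 * a, a - 3 * b, ?_⟩, ?_, ?_⟩
      · simp [one', n2, n3, n4, x, y]
        constructor <;> ring
      · simp [chi, chi0, mul', star, one', x, y]
        ring
      · simp [chi, chi0, mul', star, e, x, y]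
        ring
  · intro a b h
    simp [x, y] at h
    exact ⟨h.1, h.2.1⟩

end GMpaper
end

section
/- Let x := 1 − 2L and y := H − 4L − (5/6)P in R. The (−1)-classes of the lattice ℤ·x ⊕ ℤ·y with respect to the Euler pairing are exactly ±x and ±(2x − y); that is, for integers a, b one has χ(a·x + b·y, a·x + b·y) = −1 if and only if (a,b) ∈ {(1,0), (−1,0), (2,−1), (−2,1)}. Equivalently, the only elements u of ℤ·x ⊕ ℤ·y with χ(u,u) = −1 are x = 1 − 2L, −x, 2x − y = 2 − H + (5/6)P, and y − 2x. -/
namespace GMpaper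

/-- The `(-1)`-classes of the lattice `ℤ·x ⊕ ℤ·y` with respect to the Euler pairing are
exactly `±x` and `±(2x - y)`: for integers `a, b`, `χ(ax + by, ax + by) = -1` iff
`(a,b) ∈ {(1,0), (-1,0), (2,-1), (-2,1)}`. -/
theorem stmt2 (a b : ℤ) :
    chi (a • x + b • y) (a • x + b • y) = -1 ↔
      ((a = 1 ∧ b = 0) ∨ (a = -1 ∧ b = 0) ∨ (a = 2 ∧ b = -1) ∨ (a = -2 ∧ b = 1)) := by
  have key : chi (a • x + b • y) (a • x + b • y) = ((-(a + 2 * b) ^ 2 - b ^ 2 : ℤ) : ℚ) := by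
    simp only [chi, chi0, mul', star, x, y, Prod.smul_mk, Prod.mk_add_mk, zsmul_eq_mul]
    push_cast
    ring
  rw [key]
  constructor
  · intro h
    have h2 : -(a + 2 * b) ^ 2 - b ^ 2 = (-1 : ℤ) := by exact_mod_cast h
    have hb1 : b ≤ 1 := by nlinarith [sq_nonneg (a + 2 * b)]
    have hb2 : -1 ≤ b := by nlinarith [sq_nonneg (a + 2 * b)]
    have hc1 : a + 2 * b ≤ 1 := by nlinarith [sq_nonneg b]
    have hc2 : -1 ≤ a + 2 * b := by nlinarith [sq_nonneg b]
    have ha1 : a ≤ 3 := by omega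
    have ha2 : -3 ≤ a := by omega
    interval_cases b <;> interval_cases a <;> simp_all
  · rintro (⟨rfl, rfl⟩ | ⟨rfl, rfl⟩ | ⟨rfl, rfl⟩ | ⟨rfl, rfl⟩) <;> norm_num

end GMpaper
end

section
/- Let v := 1 − 3L + (1/2)P and w := H − 6L + (1/6)P in R. The Kuznetsov component lattice ℤ·v ⊕ ℤ·w has exactly two (−1)-classes up to sign with respect to the Euler pairing: for integers a, b one has χ(a·v + b·w, a·v + b·w) = −1 if and only if (a,b) ∈ {(−1,1), (1,−1), (−2,1), (2,−1)}; equivalently, the only elements u of ℤ·v ⊕ ℤ·w with χ(u,u) = −1 are ±(w − v) and ±(w − 2v). -/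
namespace GMpaper

/-- `v = 1 - 3L + (1/2)P`. -/
def v : R4 := (1, 0, -3, 1/2)
/-- `w = H - 6L + (1/6)P`. -/
def w : R4 := (0, 1, -6, 1/6)

/-- The Kuznetsov component lattice `ℤ·v ⊕ ℤ·w` has exactly two `(-1)`-classes up to
sign: for integers `a, b`, `χ(av + bw, av + bw) = -1` iff
`(a,b) ∈ {(-1,1), (1,-1), (-2,1), (2,-1)}`, i.e. the `(-1)`-classes are `±(w - v)` and
`±(w - 2v)`. -/
theorem stmt4 (a b : ℤ) :
    chi (a • v + b • w) (a • v + b • w) = -1 ↔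
      ((a = -1 ∧ b = 1) ∨ (a = 1 ∧ b = -1) ∨ (a = -2 ∧ b = 1) ∨ (a = 2 ∧ b = -1)) := by
  have key : chi (a • v + b • w) (a • v + b • w) = ((-(2*a^2+6*a*b+5*b^2) : ℤ) : ℚ) := by
    simp only [chi, chi0, mul', star, v, w, Prod.fst_add, Prod.snd_add, Prod.smul_fst,
      Prod.smul_snd]
    simp only [zsmul_eq_mul]
    push_cast
    ring
  rw [key]
  constructor
  · intro h
    have h1 : -(2*a^2+6*a*b+5*b^2) = -1 := by exact_mod_cast h
    have hb1 : b ≤ 1 := by nlinarith [sq_nonneg (2*a+3*b)]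
    have hb2 : -1 ≤ b := by nlinarith [sq_nonneg (2*a+3*b)]
    have ha1 : a ≤ 2 := by nlinarith [sq_nonneg (5*b+3*a)]
    have ha2 : -2 ≤ a := by nlinarith [sq_nonneg (5*b+3*a)]
    interval_cases b <;> interval_cases a <;> simp_all
  · rintro (⟨rfl, rfl⟩ | ⟨rfl, rfl⟩ | ⟨rfl, rfl⟩ | ⟨rfl, rfl⟩) <;> norm_num

end GMpaper
end

section
/- Let x := 1 − 2L, y := H − 4L − (5/6)P, v := 1 − 3L + (1/2)P, and w := H − 6L + (1/6)P in R. The Euler pairing is negative definite on both rank-2 lattices ℤ·x ⊕ ℤ·y and ℤ·v ⊕ ℤ·w: for every nonzero pair of integers (a,b), one has χ(a·x + b·y, a·x + b·y) ≤ −1 and χ(a·v + b·w, a·v + b·w) ≤ −1. (This is the numerical input behind the fact that every nonzero object A of the heart of a Serre-invariant stability condition on the Kuznetsov component satisfies ext¹(A,A) ≥ 2.) -/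
namespace GMpaper

theorem sq_aux (p q : ℤ) (h : ¬(p = 0 ∧ q = 0)) : (1 : ℚ) ≤ (p : ℚ) ^ 2 + (q : ℚ) ^ 2 := by
  have : (1 : ℤ) ≤ p ^ 2 + q ^ 2 := by
    by_contra hc
    have hp := sq_nonneg p
    have hq := sq_nonneg q
    have h1 : p ^ 2 = 0 := by omega
    have h2 : q ^ 2 = 0 := by omega
    exact h ⟨by simpa using h1, by simpa using h2⟩
  exact_mod_cast this

/-- The Euler pairing is negative definite on both rank-2 lattices `ℤ·x ⊕ ℤ·y` and
`ℤ·v ⊕ ℤ·w`: for every nonzero pair of integers `(a,b)`, one has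
`χ(ax + by, ax + by) ≤ -1` and `χ(av + bw, av + bw) ≤ -1`. -/
theorem stmt5 (a b : ℤ) (hab : ¬(a = 0 ∧ b = 0)) :
    chi (a • x + b • y) (a • x + b • y) ≤ -1 ∧
    chi (a • v + b • w) (a • v + b • w) ≤ -1 := by
  have h1 := sq_aux (a + 2 * b) b (by omega)
  have h2 := sq_aux (a + b) (a + 2 * b) (by omega)
  push_cast at h1 h2
  constructor
  · simp only [chi, chi0, mul', star, x, y, Prod.fst_add, Prod.snd_add, Prod.smul_fst,
      Prod.smul_snd]
    simp only [zsmul_eq_mul]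
    linarith
  · simp only [chi, chi0, mul', star, v, w, Prod.fst_add, Prod.snd_add, Prod.smul_fst,
      Prod.smul_snd]
    simp only [zsmul_eq_mul]
    linarith

end GMpaper
end

section
/- (Weak Mukai Lemma) Let k be a field and let 𝒞 be a k-linear triangulated (pretriangulated) category whose morphism spaces are finite-dimensional over k. Let A → E → B → A⟦1⟧ be a distinguished triangle in 𝒞, and assume Hom(A, B) = 0 and Hom(B, A⟦2⟧) = 0. Then dim_k Hom(A, A⟦1⟧) + dim_k Hom(B, B⟦1⟧) ≤ dim_k Hom(E, E⟦1⟧); in other words, ext¹(A,A) + ext¹(B,B) ≤ ext¹(E,E). -/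
open CategoryTheory CategoryTheory.Limits CategoryTheory.Pretriangulated

/-- **Weak Mukai Lemma.** Let `𝒞` be a `k`-linear (pre)triangulated category whose
morphism spaces are finite-dimensional over the field `k`. If `A → E → B → A⟦1⟧`
is a distinguished triangle with `Hom(A, B) = 0` and `Hom(B, A⟦2⟧) = 0`, then
`ext¹(A,A) + ext¹(B,B) ≤ ext¹(E,E)`. -/
theorem weak_mukai_lemma
    (k : Type*) [Field k]
    (C : Type*) [Category C] [Preadditive C] [Linear k C]
    [HasZeroObject C] [HasShift C ℤ] [∀ n : ℤ, (shiftFunctor C n).Additive]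
    [Pretriangulated C]
    [∀ X Y : C, FiniteDimensional k (X ⟶ Y)]
    (T : Triangle C) (hT : T ∈ distTriang C)
    (h1 : ∀ f : T.obj₁ ⟶ T.obj₃, f = 0)
    (h2 : ∀ g : T.obj₃ ⟶ T.obj₁⟦(2 : ℤ)⟧, g = 0) :
    Module.finrank k (T.obj₁ ⟶ T.obj₁⟦(1 : ℤ)⟧) +
      Module.finrank k (T.obj₃ ⟶ T.obj₃⟦(1 : ℤ)⟧) ≤
      Module.finrank k (T.obj₂ ⟶ T.obj₂⟦(1 : ℤ)⟧) := by
  have hz : ∀ g : T.obj₃ ⟶ (T.obj₁⟦(1 : ℤ)⟧)⟦(1 : ℤ)⟧, g = 0 := by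
    intro g
    have := h2 (g ≫ (shiftFunctorAdd' C (1 : ℤ) 1 2 (by norm_num)).inv.app T.obj₁)
    rw [← cancel_mono ((shiftFunctorAdd' C (1 : ℤ) 1 2 (by norm_num)).inv.app T.obj₁), this,
      zero_comp]
  have hx : ∀ x : T.obj₁ ⟶ T.obj₁⟦(1 : ℤ)⟧, x ≫ T.mor₁⟦(1 : ℤ)⟧' = 0 → x = 0 := by
    intro x h
    obtain ⟨g, hg⟩ := T.coyoneda_exact₁ hT x h
    rw [hg, h1 g, zero_comp]
  have hy : ∀ y : T.obj₃ ⟶ T.obj₃⟦(1 : ℤ)⟧, T.mor₂ ≫ y = 0 → y = 0 := by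
    intro y h
    obtain ⟨g, hg⟩ := T.yoneda_exact₃ hT y h
    obtain ⟨g', rfl⟩ := (shiftFunctor C (1 : ℤ)).map_surjective g
    rw [hg, h1 g', Functor.map_zero, comp_zero]
  have hs : ∀ (x : T.obj₁ ⟶ T.obj₁⟦(1 : ℤ)⟧) (y : T.obj₃ ⟶ T.obj₃⟦(1 : ℤ)⟧),
      ∃ e : T.obj₂ ⟶ T.obj₂⟦(1 : ℤ)⟧,
        T.mor₁ ≫ e = x ≫ T.mor₁⟦(1 : ℤ)⟧' ∧ e ≫ T.mor₂⟦(1 : ℤ)⟧' = T.mor₂ ≫ y := by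
    intro x y
    obtain ⟨e, he1, he2⟩ := complete_distinguished_triangle_morphism₂ T _ hT
      (Triangle.shift_distinguished T hT 1) x y ((hz _).trans (hz _).symm)
    change T.obj₂ ⟶ T.obj₂⟦(1 : ℤ)⟧ at e
    change T.mor₁ ≫ e = x ≫ ((1 : ℤ).negOnePow • T.mor₁⟦(1 : ℤ)⟧') at he1
    change T.mor₂ ≫ y = e ≫ ((1 : ℤ).negOnePow • T.mor₂⟦(1 : ℤ)⟧') at he2
    rw [Int.negOnePow_one, Units.neg_smul, one_smul, Preadditive.comp_neg] at he1 he2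
    refine ⟨-e, ?_, ?_⟩
    · rw [Preadditive.comp_neg, he1, neg_neg]
    · rw [Preadditive.neg_comp, he2]
  let W : Submodule k ((T.obj₂ ⟶ T.obj₂⟦(1 : ℤ)⟧) ×
      ((T.obj₁ ⟶ T.obj₁⟦(1 : ℤ)⟧) × (T.obj₃ ⟶ T.obj₃⟦(1 : ℤ)⟧))) :=
    { carrier := {p | T.mor₁ ≫ p.1 = p.2.1 ≫ T.mor₁⟦(1 : ℤ)⟧' ∧
        p.1 ≫ T.mor₂⟦(1 : ℤ)⟧' = T.mor₂ ≫ p.2.2}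
      add_mem' := by
        rintro p q ⟨h, h'⟩ ⟨h3, h4⟩
        simp [h, h', h3, h4]
      zero_mem' := by simp
      smul_mem' := by
        rintro c p ⟨h, h'⟩
        simp [h, h'] }
  have hsurj : Function.Surjective ((LinearMap.snd k _ _).comp W.subtype) := by
    rintro ⟨x, y⟩
    obtain ⟨e, he⟩ := hs x y
    exact ⟨⟨(e, x, y), he⟩, rfl⟩
  have hinj : Function.Injective ((LinearMap.fst k _ _).comp W.subtype) := by
    rw [injective_iff_map_eq_zero]
    rintro ⟨⟨e, x, y⟩, h, h'⟩ he
    change e = 0 at he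
    subst he
    have e1 := hx x (by simpa using h.symm)
    have e2 := hy y (by simpa using h'.symm)
    subst e1 e2
    rfl
  rw [← Module.finrank_prod]
  exact (LinearMap.finrank_le_finrank_of_surjective hsurj).trans
    (LinearMap.finrank_le_finrank_of_injective hinj)
end
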